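/- Let $G$ be a $6$-double-critical graph that is claw-free, and suppose that $|N(x) \cap N(y)| \ge 5$ for every edge $xy \in E(G)$. Then $G$ is isomorphic to the complete graph $K_6$. -/

import Mathlib

open SimpleGraph

/-- A connected graph `G` with chromatic number `n` is `n`-double-critical if
deleting the two endpoints of any edge drops the chromatic number to `n - 2`. -/
def DoubleCritical {V : Type*} (G : SimpleGraph V) (n : ℕ) : Prop :=
  G.Connected ∧ G.chromaticNumber = (n : ℕ∞) ∧
    ∀ x y : V, G.Adj x y →
      (G.induce ({x, y}ᶜ : Set V)).chromaticNumber = ((n - 2 : ℕ) : ℕ∞)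

/-- A graph is claw-free if it has no induced `K_{1,3}`. -/
def ClawFree {V : Type*} (G : SimpleGraph V) : Prop :=
  ∀ v a b c : V, G.Adj v a → G.Adj v b → G.Adj v c →
    a ≠ b → a ≠ c → b ≠ c → ¬ G.Adj a b → ¬ G.Adj a c → ¬ G.Adj b c → False

/-- In a 6-double-critical graph, every edge meets every clique on five vertices. -/
lemma DoubleCritical.not_adj_of_isNClique {V : Type*} {G : SimpleGraph V}
    (hdc : DoubleCritical G 6) {K : Finset V} (hK : G.IsNClique 5 K) {y z : V}
    (hy : y ∉ K) (hz : z ∉ K) : ¬ G.Adj y z := by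
  classical
  intro hyz
  have hcol : (G.induce ({y, z}ᶜ : Set V)).Colorable 4 :=
    chromaticNumber_le_iff_colorable.mp (hdc.2.2 y z hyz).le
  have hsub : ∀ w ∈ K, w ∈ ({y, z}ᶜ : Set V) := by
    intro w hw
    simp only [Set.mem_compl_iff, Set.mem_insert_iff, Set.mem_singleton_iff, not_or]
    exact ⟨fun e => hy (e ▸ hw), fun e => hz (e ▸ hw)⟩
  have hcl : (G.induce ({y, z}ᶜ : Set V)).IsClique
      (K.subtype (· ∈ ({y, z}ᶜ : Set V)) : Finset ({y, z}ᶜ : Set V)) := by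
    intro a ha b hb hab
    simp only [Finset.mem_coe, Finset.mem_subtype] at ha hb
    exact hK.1 ha hb fun e => hab (Subtype.ext e)
  have hle := hcl.card_le_of_colorable hcol
  rw [Finset.card_subtype, Finset.filter_true_of_mem hsub, hK.2] at hle
  omega

lemma SimpleGraph.CliqueFree.false_of_five_adj {V : Type*} {G : SimpleGraph V} (hf : G.CliqueFree 5) {a b c d e : V}
    (hab : G.Adj a b) (hac : G.Adj a c) (had : G.Adj a d) (hae : G.Adj a e)
    (hbc : G.Adj b c) (hbd : G.Adj b d) (hbe : G.Adj b e)
    (hcd : G.Adj c d) (hce : G.Adj c e) (hde : G.Adj d e) : False := by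
  classical
  have h2 : G.IsNClique 3 {c, d, e} := is3Clique_triple_iff.mpr ⟨hcd, hce, hde⟩
  have h3 : G.IsNClique 4 (insert b {c, d, e}) := h2.insert (by simp [*])
  exact hf _ (h3.insert (a := a) (by simp [*]))

section

variable {V : Type*} [Fintype V] {G : SimpleGraph V}

open Classical in
/-- A 6-double-critical graph whose edges all lie in at least five triangles has no clique on five
vertices. -/
lemma DoubleCritical.cliqueFree_five (hdc : DoubleCritical G 6)
    (h : ∀ x y : V, G.Adj x y → 5 ≤ (Finset.univ.filter fun w => G.Adj x w ∧ G.Adj y w).card) :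
    G.CliqueFree 5 := by
  intro K hK
  obtain ⟨x, hx, k, hk, hxk⟩ := Finset.one_lt_card.mp (by rw [hK.2]; norm_num : 1 < K.card)
  obtain ⟨y, hy, hyK⟩ : ∃ y ∈ Finset.univ.filter fun w => G.Adj x w ∧ G.Adj k w,
      y ∉ K.erase x := by
    refine Finset.exists_mem_notMem_of_card_lt_card ?_
    rw [Finset.card_erase_of_mem hx, hK.2]
    exact lt_of_lt_of_le (by norm_num) (h x k (hK.1 hx hk hxk))
  simp only [Finset.mem_filter_univ] at hy
  have hyK' : y ∉ K := fun e => hyK (Finset.mem_erase.mpr ⟨hy.1.ne', e⟩)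
  have hsub : (Finset.univ.filter fun w => G.Adj x w ∧ G.Adj y w) ⊆ K.erase x := by
    intro w hw
    simp only [Finset.mem_filter_univ] at hw
    refine Finset.mem_erase.mpr ⟨hw.1.ne', ?_⟩
    by_contra hwK
    exact hdc.not_adj_of_isNClique hK hyK' hwK hw.2
  have hle := (h x y hy.1).trans (Finset.card_le_card hsub)
  rw [Finset.card_erase_of_mem hx, hK.2] at hle
  omega

open Classical in
/-- In a claw-free graph without a clique on five vertices, the vertices of a triangle have at most
two common neighbors. -/
lemma ClawFree.card_common_adj_le (hcf : ClawFree G) (hf : G.CliqueFree 5) {x v u : V}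
    (hxv : G.Adj x v) (hxu : G.Adj x u) (hvu : G.Adj v u) :
    (Finset.univ.filter fun w => G.Adj x w ∧ G.Adj v w ∧ G.Adj u w).card ≤ 2 := by
  by_contra! hc
  obtain ⟨a, ha, b, hb, c, hc, hab, hac, hbc⟩ := Finset.two_lt_card.mp hc
  simp only [Finset.mem_filter_univ] at ha hb hc
  have key : ∀ p q, (G.Adj x p ∧ G.Adj v p ∧ G.Adj u p) → (G.Adj x q ∧ G.Adj v q ∧ G.Adj u q) →
      ¬ G.Adj p q := fun p q hp hq hpq =>
    hf.false_of_five_adj hxv hxu hp.1 hq.1 hvu hp.2.1 hq.2.1 hp.2.2 hq.2.2 hpq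
  exact hcf x a b c ha.1 hb.1 hc.1 hab hac hbc (key a b ha hb) (key a c ha hc) (key b c hb hc)

open Classical in
/-- In a claw-free graph without a clique on five vertices, at most two common neighbors of `x` and
`v` are distinct from and nonadjacent to a given neighbor `u` of `x`. -/
lemma ClawFree.card_common_not_adj_le (hcf : ClawFree G) (hf : G.CliqueFree 5) {x v u : V}
    (hxv : G.Adj x v) (hxu : G.Adj x u) :
    (Finset.univ.filter fun w => G.Adj x w ∧ G.Adj v w ∧ ¬ G.Adj u w ∧ w ≠ u).card ≤ 2 := by
  by_contra! hc
  obtain ⟨a, ha, b, hb, c, hc, hab, hac, hbc⟩ := Finset.two_lt_card.mp hc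
  simp only [Finset.mem_filter_univ] at ha hb hc
  have key : ∀ p q, p ≠ q → (G.Adj x p ∧ G.Adj v p ∧ ¬ G.Adj u p ∧ p ≠ u) →
      (G.Adj x q ∧ G.Adj v q ∧ ¬ G.Adj u q ∧ q ≠ u) → G.Adj p q := by
    intro p q hpq hp hq
    by_contra hn
    exact hcf x u p q hxu hp.1 hq.1 hp.2.2.2.symm hq.2.2.2.symm hpq hp.2.2.1 hq.2.2.1 hn
  exact hf.false_of_five_adj hxv ha.1 hb.1 hc.1 ha.2.1 hb.2.1 hc.2.1
    (key a b hab ha hb) (key a c hac ha hc) (key b c hbc hb hc)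

open Classical in
lemma SimpleGraph.card_common_split {x v u : V} (hxu : G.Adj x u) (hvu : G.Adj v u) :
    (Finset.univ.filter fun w => G.Adj x w ∧ G.Adj v w).card =
      (Finset.univ.filter fun w => G.Adj x w ∧ G.Adj v w ∧ G.Adj u w).card +
      (Finset.univ.filter fun w => G.Adj x w ∧ G.Adj v w ∧ ¬ G.Adj u w ∧ w ≠ u).card + 1 := by
  have hu : u ∈ Finset.univ.filter fun w => G.Adj x w ∧ G.Adj v w := by simp [hxu, hvu]
  rw [← Finset.card_erase_add_one hu, ← Finset.card_filter_add_card_filter_not (fun w => G.Adj u w)]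
  congr 3
  · ext w
    simp only [Finset.mem_filter, Finset.mem_erase, Finset.mem_univ, true_and]
    exact ⟨fun hw => ⟨hw.1.2.1, hw.1.2.2, hw.2⟩,
      fun hw => ⟨⟨hw.2.2.ne', hw.1, hw.2.1⟩, hw.2.2⟩⟩
  · ext w
    simp only [Finset.mem_filter, Finset.mem_erase, Finset.mem_univ, true_and]
    tauto

open Classical in
/-- A claw-free graph without a clique on five vertices has an edge in at most four triangles,
unless it has no edge. -/
lemma ClawFree.not_adj_of_cliqueFree_five (hcf : ClawFree G) (hf : G.CliqueFree 5)
    (h : ∀ x y : V, G.Adj x y → 5 ≤ (Finset.univ.filter fun w => G.Adj x w ∧ G.Adj y w).card)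
    (x v : V) : ¬ G.Adj x v := by
  intro hxv
  have htri : ∀ v u, G.Adj x v → G.Adj x u → G.Adj v u →
      (Finset.univ.filter fun w => G.Adj x w ∧ G.Adj v w).card = 5 ∧
      (Finset.univ.filter fun w => G.Adj x w ∧ G.Adj v w ∧ G.Adj u w).card = 2 := by
    intro v u hxv hxu hvu
    have h1 := hcf.card_common_adj_le hf hxv hxu hvu
    have h2 := hcf.card_common_not_adj_le hf hxv hxu
    have h3 := SimpleGraph.card_common_split hxu hvu
    have h4 := h x v hxv
    omega
  have hfive : ∀ v, G.Adj x v →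
      (Finset.univ.filter fun w => G.Adj x w ∧ G.Adj v w).card = 5 := by
    intro v hxv
    obtain ⟨u, hu⟩ := Finset.card_pos.mp (lt_of_lt_of_le (by norm_num) (h x v hxv))
    simp only [Finset.mem_filter_univ] at hu
    exact (htri v u hxv hu.1 hu.2).1
  set J := Finset.univ.filter fun w => G.Adj x w ∧ G.Adj v w with hJ
  set A := Finset.univ.filter fun w => G.Adj x w ∧ ¬ G.Adj v w ∧ w ≠ v with hA
  have hJA : ∀ u ∈ J, (A.bipartiteAbove G.Adj u).card = 2 := by
    intro u hu
    simp only [hJ, Finset.mem_filter_univ] at hu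
    have h1 := hfive u hu.1
    rw [SimpleGraph.card_common_split hxv hu.2.symm, (htri u v hu.1 hxv hu.2.symm).2] at h1
    have h2 : A.bipartiteAbove G.Adj u =
        Finset.univ.filter fun w => G.Adj x w ∧ G.Adj u w ∧ ¬ G.Adj v w ∧ w ≠ v := by
      ext w
      simp only [hA, Finset.bipartiteAbove, Finset.mem_filter, Finset.mem_univ, true_and]
      tauto
    rw [h2]
    omega
  have hAJ : ∀ a ∈ A, (J.bipartiteBelow G.Adj a).card = 6 - A.card := by
    intro a ha
    have ha' := ha
    simp only [hA, Finset.mem_filter_univ] at ha'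
    have h1 := hfive a ha'.1
    rw [← Finset.card_filter_add_card_filter_not (fun w => G.Adj v w)] at h1
    have h2 : J.bipartiteBelow G.Adj a =
        (Finset.univ.filter fun w => G.Adj x w ∧ G.Adj a w).filter fun w => G.Adj v w := by
      ext w
      simp only [hJ, Finset.bipartiteBelow, Finset.mem_filter, Finset.mem_univ, true_and,
        G.adj_comm w a]
      tauto
    have h3 : A.erase a =
        (Finset.univ.filter fun w => G.Adj x w ∧ G.Adj a w).filter fun w => ¬ G.Adj v w := by
      ext w
      simp only [hA, Finset.mem_erase, Finset.mem_filter, Finset.mem_univ, true_and]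
      constructor
      · rintro ⟨hwa, hxw, hvw, hwv⟩
        refine ⟨⟨hxw, ?_⟩, hvw⟩
        by_contra hn
        exact hcf x v a w hxv ha'.1 hxw ha'.2.2.symm hwv.symm hwa.symm ha'.2.1 hvw hn
      · rintro ⟨⟨hxw, haw⟩, hvw⟩
        exact ⟨haw.ne', hxw, hvw, fun e => ha'.2.1 (e ▸ haw).symm⟩
    have h4 := Finset.card_erase_add_one ha
    rw [← h2, ← h3] at h1
    omega
  have hcount := Finset.card_mul_eq_card_mul G.Adj hJA hAJ
  rw [hfive v hxv] at hcount
  rcases le_or_gt A.card 6 with hm | hm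
  · generalize A.card = m at hcount hm
    interval_cases m <;> omega
  · rw [Nat.sub_eq_zero_of_le hm.le] at hcount
    omega

end

/-- If in a claw-free 6-double-critical graph every pair of adjacent vertices
has at least 5 common neighbors, then the graph is isomorphic to $K_6$. -/
theorem stmt_9 {V : Type*} [Fintype V] (G : SimpleGraph V)
    (hdc : DoubleCritical G 6) (hcf : ClawFree G)
    (h : ∀ x y : V, G.Adj x y →
      5 ≤ (G.neighborSet x ∩ G.neighborSet y).ncard) :
    Nonempty (G ≃g (⊤ : SimpleGraph (Fin 6))) := by
  classical
  exfalso
  have h' : ∀ x y : V, G.Adj x y →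
      5 ≤ (Finset.univ.filter fun w => G.Adj x w ∧ G.Adj y w).card := by
    intro x y hxy
    rw [← Set.ncard_coe_finset]
    convert h x y hxy using 2
    ext w
    simp
  have hno := hcf.not_adj_of_cliqueFree_five (hdc.cliqueFree_five h') h'
  have hcol : G.Colorable 1 := ⟨Coloring.mk (fun _ => 0) fun {a b} hab => (hno a b hab).elim⟩
  have hle := hcol.chromaticNumber_le
  rw [hdc.2.1] at hle
  exact absurd hle (by decide)
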